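/- arXiv:2304.12073 — 2 statements merged into one kernel-verified Lean document; each statement's English description precedes it below -/
import Mathlib

section
/- Let K_{r_1,…,r_k} be a complete multipartite graph with k ≥ 3 parts, smallest part of size r_k = 2, some part of size exactly 3 (r_j = 3 for some j), and an odd total number of vertices n = r_1 + … + r_k. Then the game chromatic number satisfies χ_g(K_{r_1,…,r_k}) = min{2k − 2, Σ_{i=1}^{k} ⌈r_i/2⌉}. -/
/-- A color `c` is legal for vertex `v` in partial coloring `f` if no neighbor of `v`
is already colored with `c`. -/
def legalColor {V C : Type} (G : SimpleGraph V) (f : V → Option C) (v : V) (c : C) : Prop :=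
  ∀ w, G.Adj v w → f w ≠ some c

/-- A move in the coloring game: choose an uncolored vertex and color it with a legal color. -/
def gameMove {V C : Type} [DecidableEq V] (G : SimpleGraph V) (f f' : V → Option C) : Prop :=
  ∃ v c, f v = none ∧ legalColor G f v c ∧ f' = Function.update f v (some c)

/-- Every vertex is colored. -/
def isFull {V C : Type} (f : V → Option C) : Prop := ∀ v, (f v).isSome

/-- Some uncolored vertex has no legal color (then Bob wins). -/
def isStuck {V C : Type} (G : SimpleGraph V) (f : V → Option C) : Prop :=
  ∃ v, f v = none ∧ ∀ c, ¬ legalColor G f v c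

/-- It is Alice's turn when an even number of vertices are colored
(Alice moves first, and each move colors exactly one vertex). -/
def aliceTurn {V C : Type} [Fintype V] (f : V → Option C) : Prop :=
  Even (Finset.univ.filter (fun v => (f v).isSome = true)).card

/-- Alice has a winning strategy from position `f` when `n` vertices remain uncolored:
Alice wins exactly the plays in which the entire graph gets colored; as soon as some
uncolored vertex has no legal color, Bob wins. -/
def aliceWinsFrom {V C : Type} [Fintype V] [DecidableEq V] (G : SimpleGraph V) :
    ℕ → (V → Option C) → Prop
  | 0, f => isFull f
  | n + 1, f => isFull f ∨ (¬ isStuck G f ∧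
      ((aliceTurn f ∧ ∃ f', gameMove G f f' ∧ aliceWinsFrom G n f') ∨
       (¬ aliceTurn f ∧ ∀ f', gameMove G f f' → aliceWinsFrom G n f')))

/-- Alice has a winning strategy in the graph coloring game on `G` with `m` colors. -/
def aliceWins {V : Type} [Fintype V] [DecidableEq V] (G : SimpleGraph V) (m : ℕ) : Prop :=
  aliceWinsFrom (C := Fin m) G (Fintype.card V) (fun _ => none)

/-- The game chromatic number: the least number of colors for which Alice has
a winning strategy. -/
noncomputable def gameChromaticNumber {V : Type} [Fintype V] [DecidableEq V]
    (G : SimpleGraph V) : ℕ :=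
  sInf {m | aliceWins G m}

/-- The complete multipartite graph `K_{r 0, …, r (k-1)}`. -/
def K (k : ℕ) (r : Fin k → ℕ) : SimpleGraph (Σ i : Fin k, Fin (r i)) :=
  SimpleGraph.completeMultipartiteGraph (fun i => Fin (r i))

namespace MultipartiteGame

section Abstract

variable {k : ℕ} (r : Fin k → ℕ)

/-- The effect of one move on the set `T` of parts without a colored vertex, the number `U` of
uncolored vertices in the other parts, and the number `c` of unused colors. -/
def Step (T : Finset (Fin k)) (U c : ℕ) (T' : Finset (Fin k)) (U' c' : ℕ) : Prop :=
  (∃ i ∈ T, T' = T.erase i ∧ U' + 1 = U + r i ∧ c' + 1 = c) ∨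
    (T' = T ∧ U' + 1 = U ∧ (c' = c ∨ c' + 1 = c))

/-- Number of colors needed for the untouched parts when vertices are paired inside parts. -/
def pairCount (T : Finset (Fin k)) : ℕ := ∑ i ∈ T, (r i + 1) / 2

variable {r}

lemma pairCount_erase {T : Finset (Fin k)} {i : Fin k} (hi : i ∈ T) :
    (r i + 1) / 2 + pairCount r (T.erase i) = pairCount r T :=
  Finset.add_sum_erase T (fun i => (r i + 1) / 2) hi

lemma sum_erase {T : Finset (Fin k)} {i : Fin k} (hi : i ∈ T) :
    r i + ∑ j ∈ T.erase i, r j = ∑ j ∈ T, r j :=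
  Finset.add_sum_erase T r hi

lemma card_erase_succ {T : Finset (Fin k)} {i : Fin k} (hi : i ∈ T) :
    (T.erase i).card + 1 = T.card := Finset.card_erase_add_one hi

/-- Invariant for the pairing strategy, Alice to move. -/
def PairA (r : Fin k → ℕ) (T : Finset (Fin k)) (U c : ℕ) : Prop :=
  pairCount r T + U / 2 ≤ c ∧ (∑ i ∈ T, r i + U) % 2 = 1

/-- Invariant for the pairing strategy, Bob to move. -/
def PairB (r : Fin k → ℕ) (T : Finset (Fin k)) (U c : ℕ) : Prop :=
  pairCount r T + (U + 1) / 2 ≤ c ∧ (∑ i ∈ T, r i + U) % 2 = 0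

lemma pairCount_pos (hr : ∀ i, 2 ≤ r i) {T : Finset (Fin k)} (hT : T.Nonempty) :
    0 < pairCount r T := by
  obtain ⟨i, hi⟩ := hT
  have h1 := pairCount_erase (r := r) hi
  have h2 := hr i
  omega

lemma PairA.step (hr : ∀ i, 2 ≤ r i) {T : Finset (Fin k)} {U c : ℕ} (h : PairA r T U c) :
    (T.Nonempty → 0 < c) ∧ ∃ T' U' c', Step r T U c T' U' c' ∧ PairB r T' U' c' := by
  obtain ⟨h1, h2⟩ := h
  refine ⟨fun hT => by have := pairCount_pos hr hT; omega, ?_⟩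
  rcases Nat.even_or_odd U with hU | hU
  · have hU' : U % 2 = 0 := Nat.even_iff.1 hU
    obtain ⟨i, hi, hodd⟩ : ∃ i ∈ T, r i % 2 = 1 := by
      by_contra! hcon
      have : 2 ∣ ∑ i ∈ T, r i := Finset.dvd_sum fun i hi => by have := hcon i hi; omega
      omega
    have e1 := pairCount_erase (r := r) hi
    have e2 := sum_erase (r := r) hi
    refine ⟨T.erase i, U + r i - 1, c - 1, Or.inl ⟨i, hi, rfl, by omega, by omega⟩, ?_, ?_⟩ <;>
      omega
  · have hU' : U % 2 = 1 := Nat.odd_iff.1 hU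
    refine ⟨T, U - 1, c, Or.inr ⟨rfl, by omega, Or.inl rfl⟩, ?_, ?_⟩ <;> omega

lemma PairB.step (hr : ∀ i, 2 ≤ r i) {T : Finset (Fin k)} {U c : ℕ} (h : PairB r T U c) :
    (T.Nonempty → 0 < c) ∧ ∀ T' U' c', Step r T U c T' U' c' → PairA r T' U' c' := by
  obtain ⟨h1, h2⟩ := h
  refine ⟨fun hT => by have := pairCount_pos hr hT; omega, ?_⟩
  rintro T' U' c' (⟨i, hi, rfl, hU, hc⟩ | ⟨rfl, hU, hc⟩)
  · have e1 := pairCount_erase (r := r) hi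
    have e2 := sum_erase (r := r) hi
    have := hr i
    constructor <;> omega
  · constructor <;> omega

/-- Invariant for the strategy with `2k - 2` colors, Alice to move. -/
def TempoA (r : Fin k → ℕ) (T : Finset (Fin k)) (U c : ℕ) : Prop :=
  2 * T.card ≤ c + 1 ∨ (U = 1 ∧ 2 ≤ T.card ∧ 2 * T.card ≤ c + 2) ∨
    (U = 0 ∧ 3 ≤ T.card ∧ 2 * T.card ≤ c + 2 ∧ ∃ i ∈ T, r i = 3)

/-- Invariant for the strategy with `2k - 2` colors, Bob to move. -/
def TempoB (T : Finset (Fin k)) (U c : ℕ) : Prop :=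
  2 * T.card ≤ c ∨ (U = 0 ∧ 2 ≤ T.card ∧ 2 * T.card ≤ c + 2) ∨
    (U = 2 ∧ 2 ≤ T.card ∧ 2 * T.card ≤ c + 1)

lemma TempoA.step (hr : ∀ i, 2 ≤ r i) {T : Finset (Fin k)} {U c : ℕ} (h : TempoA r T U c)
    (hne : T.Nonempty ∨ 0 < U) :
    (T.Nonempty → 0 < c) ∧ ∃ T' U' c', Step r T U c T' U' c' ∧ TempoB T' U' c' := by
  refine ⟨fun hT => ?_, ?_⟩
  · have := hT.card_pos
    rcases h with h | h | ⟨h1, h2, h3, -⟩ <;> omega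
  rcases h with h | ⟨h1, h2, h3⟩ | ⟨h1, h2, h3, i, hi, hi3⟩
  · by_cases hT : T.Nonempty
    · obtain ⟨i, hi⟩ := hT
      have e1 := card_erase_succ hi
      have := hr i
      exact ⟨T.erase i, U + r i - 1, c - 1, Or.inl ⟨i, hi, rfl, by omega, by omega⟩,
        Or.inl (by omega)⟩
    · have hU : 0 < U := hne.resolve_left hT
      have hc : T.card = 0 := by simpa [Finset.not_nonempty_iff_eq_empty] using hT
      exact ⟨T, U - 1, c, Or.inr ⟨rfl, by omega, Or.inl rfl⟩, Or.inl (by omega)⟩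
  · exact ⟨T, 0, c, Or.inr ⟨rfl, by omega, Or.inl rfl⟩, Or.inr (Or.inl ⟨rfl, h2, h3⟩)⟩
  · have e1 := card_erase_succ hi
    exact ⟨T.erase i, 2, c - 1, Or.inl ⟨i, hi, rfl, by omega, by omega⟩,
      Or.inr (Or.inr ⟨rfl, by omega, by omega⟩)⟩

lemma TempoB.step {T : Finset (Fin k)} {U c : ℕ} (h : TempoB T U c) :
    (T.Nonempty → 0 < c) ∧ ∀ T' U' c', Step r T U c T' U' c' → TempoA r T' U' c' := by
  refine ⟨fun hT => ?_, ?_⟩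
  · have := hT.card_pos
    rcases h with h | h | h <;> omega
  rintro T' U' c' (⟨i, hi, rfl, hU, hc⟩ | ⟨rfl, hU, hc⟩)
  · have e1 := card_erase_succ hi
    left
    rcases h with h | h | h <;> omega
  · rcases h with h | h | h
    · left; omega
    · omega
    · right; left; omega

/-- Invariant for Bob's strategy, Alice to move. -/
def BobA (r : Fin k → ℕ) (T : Finset (Fin k)) (U c : ℕ) : Prop :=
  c < pairCount r T + U / 2 ∧ c + 1 < 2 * T.card ∧ (U = 1 → 2 ≤ T.card → c + 2 < 2 * T.card) ∧
    (U = 0 → 3 ≤ T.card → (∃ i ∈ T, r i = 3) → c + 2 < 2 * T.card)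

/-- Invariant for Bob's strategy, Bob to move. -/
def BobB (r : Fin k → ℕ) (T : Finset (Fin k)) (U c : ℕ) : Prop :=
  c < pairCount r T + (U + 1) / 2 ∧ c < 2 * T.card ∧ (U = 0 → c + 1 < 2 * T.card) ∧
    (U = 0 → 2 ≤ T.card → c + 2 < 2 * T.card) ∧ (U = 2 → 2 ≤ T.card → c + 1 < 2 * T.card) ∧
    (U = 1 → 3 ≤ T.card → (∃ i ∈ T, r i = 3) → c + 1 < 2 * T.card)

lemma BobA.step (hr : ∀ i, 2 ≤ r i) {T : Finset (Fin k)} {U c : ℕ} (h : BobA r T U c)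
    {T' : Finset (Fin k)} {U' c' : ℕ} (hs : Step r T U c T' U' c') : BobB r T' U' c' := by
  obtain ⟨h1, h2, h3, h4⟩ := h
  rcases hs with ⟨i, hi, rfl, hU, hc⟩ | ⟨rfl, hU, hc⟩
  · have e1 := card_erase_succ hi
    have e2 := pairCount_erase (r := r) hi
    have hri := hr i
    refine ⟨by omega, by omega, by omega, by omega, fun hU2 hT => ?_, fun hU1 hT hex => ?_⟩
    · by_cases hU1 : U = 1
      · have := h3 hU1; omega
      · have := h4 (by omega) (by omega) ⟨i, hi, by omega⟩; omega
    · obtain ⟨j, hj, hj3⟩ := hex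
      have := h4 (by omega) (by omega) ⟨j, Finset.mem_of_mem_erase hj, hj3⟩; omega
  · refine ⟨by omega, by omega, by omega, by omega, by omega, fun hU1 hT hex => ?_⟩
    omega

lemma BobB.step (hr : ∀ i, 2 ≤ r i) {T : Finset (Fin k)} {U c : ℕ} (h : BobB r T U c)
    (hc : 0 < c) : ∃ T' U' c', Step r T U c T' U' c' ∧ BobA r T' U' c' := by
  obtain ⟨h1, h2, h3, h4, h5, h6⟩ := h
  by_cases hU : U = 0
  · subst hU
    have hex : ∃ i ∈ T, 2 < r i ∨ pairCount r T = T.card := by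
      by_cases hbig : ∃ i ∈ T, 2 < r i
      · obtain ⟨i, hi, hi2⟩ := hbig
        exact ⟨i, hi, Or.inl hi2⟩
      · push Not at hbig
        obtain ⟨i, hi⟩ : T.Nonempty := Finset.card_pos.1 (by omega)
        refine ⟨i, hi, Or.inr ?_⟩
        rw [pairCount, Finset.card_eq_sum_ones]
        refine Finset.sum_congr rfl fun j hj => ?_
        have := hr j
        have := hbig j hj
        omega
    obtain ⟨i, hi, hcase⟩ := hex
    have e1 := card_erase_succ hi
    have e2 := pairCount_erase (r := r) hi
    have hri := hr i
    refine ⟨T.erase i, r i - 1, c - 1, Or.inl ⟨i, hi, rfl, by omega, by omega⟩, by omega,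
      by omega, ?_, by omega⟩
    intro hr2 hT
    rcases hcase with hcase | hcase <;> omega
  · exact ⟨T, U - 1, c - 1, Or.inr ⟨rfl, by omega, Or.inr (by omega)⟩, by omega, by omega,
      by omega, fun hU0 hT hex => by have := h6 (by omega) hT hex; omega⟩

end Abstract

section Position

variable {k m : ℕ} {r : Fin k → ℕ}

/-- Two vertices of the same color lie in the same part. -/
def Proper (f : (Σ i : Fin k, Fin (r i)) → Option (Fin m)) : Prop :=
  ∀ v w c, f v = some c → f w = some c → v.1 = w.1

/-- The parts without a colored vertex. -/
def untouched (f : (Σ i : Fin k, Fin (r i)) → Option (Fin m)) : Finset (Fin k) :=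
  {i | ∀ x, f ⟨i, x⟩ = none}

/-- The uncolored vertices. -/
def uncolored (f : (Σ i : Fin k, Fin (r i)) → Option (Fin m)) :
    Finset (Σ i : Fin k, Fin (r i)) :=
  {v | f v = none}

/-- The number of uncolored vertices in parts that contain a colored vertex. -/
def loose (f : (Σ i : Fin k, Fin (r i)) → Option (Fin m)) : ℕ :=
  ((uncolored f).filter fun v => v.1 ∉ untouched f).card

/-- The colors not used so far. -/
def unused (f : (Σ i : Fin k, Fin (r i)) → Option (Fin m)) : Finset (Fin m) :=
  {c | ∀ v, f v ≠ some c}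

variable {f : (Σ i : Fin k, Fin (r i)) → Option (Fin m)}

lemma mem_untouched {i : Fin k} : i ∈ untouched f ↔ ∀ x, f ⟨i, x⟩ = none := by
  simp [untouched]

lemma mem_uncolored {v : Σ i : Fin k, Fin (r i)} : v ∈ uncolored f ↔ f v = none := by
  simp [uncolored]

lemma mem_unused {c : Fin m} : c ∈ unused f ↔ ∀ v, f v ≠ some c := by
  simp [unused]

lemma K_adj {v w : Σ i : Fin k, Fin (r i)} : (K k r).Adj v w ↔ v.1 ≠ w.1 := Iff.rfl

lemma card_uncolored (f : (Σ i : Fin k, Fin (r i)) → Option (Fin m)) :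
    (uncolored f).card = loose f + ∑ i ∈ untouched f, r i := by
  have h : (uncolored f).filter (fun v => v.1 ∈ untouched f) =
      (untouched f).sigma fun _ => Finset.univ := by
    ext ⟨i, x⟩
    simp only [Finset.mem_filter, mem_uncolored, Finset.mem_sigma, Finset.mem_univ, and_true,
      and_iff_right_iff_imp]
    exact fun hi => mem_untouched.1 hi x
  have h2 := Finset.card_filter_add_card_filter_not (s := uncolored f)
    (fun v => v.1 ∈ untouched f)
  rw [h, Finset.card_sigma] at h2
  simp only [Finset.card_univ, Fintype.card_fin] at h2
  rw [loose]
  omega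

section Update

variable {v : Σ i : Fin k, Fin (r i)} {c : Fin m}

lemma uncolored_update : uncolored (Function.update f v (some c)) = (uncolored f).erase v := by
  ext w
  by_cases h : w = v <;> simp [mem_uncolored, h]

lemma card_uncolored_update (hv : f v = none) :
    (uncolored (Function.update f v (some c))).card + 1 = (uncolored f).card := by
  rw [uncolored_update, Finset.card_erase_add_one (mem_uncolored.2 hv)]

lemma untouched_update :
    untouched (Function.update f v (some c)) = (untouched f).erase v.1 := by
  ext i
  simp only [Finset.mem_erase, mem_untouched]
  constructor
  · intro h
    refine ⟨?_, fun x => ?_⟩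
    · rintro rfl
      simpa using h v.2
    · have := h x
      by_cases hx : (⟨i, x⟩ : Σ i : Fin k, Fin (r i)) = v
      · simp [hx] at this
      · simpa [Function.update_apply, hx] using this
  · rintro ⟨hi, h⟩ x
    have hx : (⟨i, x⟩ : Σ i : Fin k, Fin (r i)) ≠ v := fun e => hi (e ▸ rfl)
    simpa [Function.update_apply, hx] using h x

lemma unused_update (hv : f v = none) :
    unused (Function.update f v (some c)) = (unused f).erase c := by
  ext d
  simp only [Finset.mem_erase, mem_unused]
  constructor
  · intro h
    refine ⟨?_, fun w hw => ?_⟩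
    · rintro rfl
      simpa using h v
    · have hwv : w ≠ v := by rintro rfl; simp [hv] at hw
      exact h w (by simpa [Function.update_apply, hwv] using hw)
  · rintro ⟨hd, h⟩ w
    by_cases hwv : w = v
    · simpa [hwv] using Ne.symm hd
    · simpa [Function.update_apply, hwv] using h w

lemma Proper.update (hf : Proper f) (hl : legalColor (K k r) f v c) :
    Proper (Function.update f v (some c)) := by
  have key : ∀ w d, w ≠ v → f w = some d → some c = some d → v.1 = w.1 := by
    intro w d _ hw hd
    by_contra hne
    exact hl w (K_adj.2 hne) (hd ▸ hw)
  intro a b d ha hb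
  rw [Function.update_apply] at ha hb
  split_ifs at ha hb with h1 h2 h2
  · rw [h1, h2]
  · rw [h1]; exact key b d h2 hb ha
  · rw [h2]; exact (key a d h1 ha hb).symm
  · exact hf a b d ha hb

lemma loose_update_of_mem (hv : f v = none) (hT : v.1 ∈ untouched f) :
    loose (Function.update f v (some c)) + 1 = loose f + r v.1 := by
  have h1 := card_uncolored f
  have h2 := card_uncolored (Function.update f v (some c))
  have h3 := card_uncolored_update (c := c) hv
  rw [untouched_update] at h2
  have h4 := sum_erase (r := r) hT
  omega

lemma loose_update_of_notMem (hv : f v = none) (hT : v.1 ∉ untouched f) :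
    loose (Function.update f v (some c)) + 1 = loose f := by
  have h1 := card_uncolored f
  have h2 := card_uncolored (Function.update f v (some c))
  have h3 := card_uncolored_update (c := c) hv
  rw [untouched_update, Finset.erase_eq_of_notMem hT] at h2
  omega

lemma card_unused_update_of_mem (hv : f v = none) (hc : c ∈ unused f) :
    (unused (Function.update f v (some c))).card + 1 = (unused f).card := by
  rw [unused_update hv, Finset.card_erase_add_one hc]

lemma legalColor_of_mem_unused (hc : c ∈ unused f) : legalColor (K k r) f v c :=
  fun w _ => mem_unused.1 hc w

end Update

lemma step_of_gameMove {f' : (Σ i : Fin k, Fin (r i)) → Option (Fin m)}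
    (h : gameMove (K k r) f f') :
    Step r (untouched f) (loose f) (unused f).card (untouched f') (loose f') (unused f').card := by
  obtain ⟨v, c, hv, hl, rfl⟩ := h
  by_cases hT : v.1 ∈ untouched f
  · have hc : c ∈ unused f := by
      refine mem_unused.2 fun w hw => ?_
      by_cases hvw : v.1 = w.1
      · have := mem_untouched.1 (hvw ▸ hT) w.2
        simp_all
      · exact hl w (K_adj.2 hvw) hw
    exact Or.inl ⟨v.1, hT, untouched_update, loose_update_of_mem hv hT,
      card_unused_update_of_mem hv hc⟩
  · refine Or.inr ⟨by rw [untouched_update, Finset.erase_eq_of_notMem hT],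
      loose_update_of_notMem hv hT, ?_⟩
    by_cases hc : c ∈ unused f
    · exact Or.inr (card_unused_update_of_mem hv hc)
    · exact Or.inl (by rw [unused_update hv, Finset.erase_eq_of_notMem hc])

lemma Proper.of_gameMove {f' : (Σ i : Fin k, Fin (r i)) → Option (Fin m)} (hf : Proper f)
    (h : gameMove (K k r) f f') : Proper f' := by
  obtain ⟨v, c, -, hl, rfl⟩ := h
  exact hf.update hl

lemma exists_gameMove_of_step (hr : ∀ i, 2 ≤ r i) (hf : Proper f)
    {T' : Finset (Fin k)} {U' c' : ℕ}
    (h : Step r (untouched f) (loose f) (unused f).card T' U' c') :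
    ∃ f', gameMove (K k r) f f' ∧ untouched f' = T' ∧ loose f' = U' ∧ (unused f').card = c' := by
  rcases h with ⟨i, hi, rfl, hU, hc⟩ | ⟨rfl, hU, hc⟩
  · obtain ⟨c, hcm⟩ : (unused f).Nonempty := Finset.card_pos.1 (by omega)
    have hri := hr i
    let v : Σ i : Fin k, Fin (r i) := ⟨i, ⟨0, by omega⟩⟩
    have hv : f v = none := mem_untouched.1 hi _
    have h1 := loose_update_of_mem (v := v) (c := c) hv hi
    have h2 := card_unused_update_of_mem hv hcm
    refine ⟨_, ⟨v, c, hv, legalColor_of_mem_unused hcm, rfl⟩, untouched_update, ?_, ?_⟩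
    · change _ = loose f + r i at h1
      omega
    · omega
  · obtain ⟨v, hv⟩ : ((uncolored f).filter fun v => v.1 ∉ untouched f).Nonempty :=
      Finset.card_pos.1 (by rw [loose] at hU; omega)
    obtain ⟨hv, hT⟩ := Finset.mem_filter.1 hv
    rw [mem_uncolored] at hv
    have h1 (c : Fin m) := loose_update_of_notMem (c := c) hv hT
    have hT' (c : Fin m) : untouched (Function.update f v (some c)) = untouched f := by
      rw [untouched_update, Finset.erase_eq_of_notMem hT]
    rcases hc with hc | hc
    · obtain ⟨x, hx⟩ : ∃ x, f ⟨v.1, x⟩ ≠ none := by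
        simpa [mem_untouched] using hT
      obtain ⟨c, hcx⟩ := Option.ne_none_iff_exists'.1 hx
      have hcm : c ∉ unused f := fun hcm => mem_unused.1 hcm _ hcx
      refine ⟨_, ⟨v, c, hv, fun w hw hwc => hw (hf ⟨_, x⟩ _ c hcx hwc), rfl⟩, hT' c,
        by have := h1 c; omega, ?_⟩
      rw [unused_update hv, Finset.erase_eq_of_notMem hcm, hc]
    · obtain ⟨c, hcm⟩ : (unused f).Nonempty := Finset.card_pos.1 (by omega)
      have h2 := card_unused_update_of_mem hv hcm
      exact ⟨_, ⟨v, c, hv, legalColor_of_mem_unused hcm, rfl⟩, hT' c,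
        by have := h1 c; omega, by omega⟩

lemma isStuck_iff (hr : ∀ i, 2 ≤ r i) (hf : Proper f) :
    isStuck (K k r) f ↔ (untouched f).Nonempty ∧ (unused f).card = 0 := by
  constructor
  · rintro ⟨v, hv, hl⟩
    have h0 : (unused f).card = 0 := by
      rw [Finset.card_eq_zero, Finset.eq_empty_iff_forall_notMem]
      exact fun c hc => hl c (legalColor_of_mem_unused hc)
    refine ⟨⟨v.1, mem_untouched.2 fun x => ?_⟩, h0⟩
    by_contra hx
    obtain ⟨c, hcx⟩ := Option.ne_none_iff_exists'.1 hx
    exact hl c fun w hw hwc => hw (hf ⟨_, x⟩ _ c hcx hwc)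
  · rintro ⟨⟨i, hi⟩, h0⟩
    have hri := hr i
    refine ⟨⟨i, ⟨0, by omega⟩⟩, mem_untouched.1 hi _, fun c hl => ?_⟩
    have hc : c ∉ unused f := by
      rw [Finset.card_eq_zero.1 h0]
      exact Finset.notMem_empty c
    obtain ⟨w, hw⟩ : ∃ w, f w = some c := by simpa [mem_unused] using hc
    refine hl w (K_adj.2 ?_) hw
    rintro rfl
    have := mem_untouched.1 hi w.2
    simp_all

lemma isFull_iff : isFull f ↔ (uncolored f).card = 0 := by
  rw [Finset.card_eq_zero, Finset.eq_empty_iff_forall_notMem]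
  simp only [mem_uncolored, isFull, Option.isSome_iff_ne_none, ne_eq]

lemma not_isFull_of_nonempty (hr : ∀ i, 2 ≤ r i) (hT : (untouched f).Nonempty) : ¬ isFull f := by
  obtain ⟨i, hi⟩ := hT
  have hri := hr i
  intro h
  simpa [mem_untouched.1 hi _] using h ⟨i, ⟨0, by omega⟩⟩

lemma aliceTurn_gameMove {f' : (Σ i : Fin k, Fin (r i)) → Option (Fin m)}
    (h : gameMove (K k r) f f') : aliceTurn f' ↔ ¬ aliceTurn f := by
  obtain ⟨v, c, hv, -, rfl⟩ := h
  have : (Finset.univ.filter fun w => ((Function.update f v (some c)) w).isSome = true) =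
      insert v (Finset.univ.filter fun w => (f w).isSome = true) := by
    ext w
    by_cases hw : w = v <;> simp [Function.update_apply, hw]
  rw [aliceTurn, aliceTurn, this, Finset.card_insert_of_notMem (by simp [hv]), Nat.even_add_one]

lemma aliceWinsFrom_of_invariant (hr : ∀ i, 2 ≤ r i) {A B : Finset (Fin k) → ℕ → ℕ → Prop}
    (hA : ∀ T U c, A T U c → (T.Nonempty ∨ 0 < U) → (T.Nonempty → 0 < c) ∧
      ∃ T' U' c', Step r T U c T' U' c' ∧ B T' U' c')
    (hB : ∀ T U c, B T U c → (T.Nonempty → 0 < c) ∧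
      ∀ T' U' c', Step r T U c T' U' c' → A T' U' c')
    (n : ℕ) (f : (Σ i : Fin k, Fin (r i)) → Option (Fin m)) (hf : Proper f)
    (hn : (uncolored f).card = n)
    (ha : aliceTurn f → A (untouched f) (loose f) (unused f).card)
    (hb : ¬ aliceTurn f → B (untouched f) (loose f) (unused f).card) :
    aliceWinsFrom (K k r) n f := by
  induction n generalizing f with
  | zero => exact isFull_iff.2 hn
  | succ n ih =>
    right
    have hne : (untouched f).Nonempty ∨ 0 < loose f := by
      by_contra! h
      have := card_uncolored f
      rw [h.1] at this
      simp at this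
      omega
    have next {f'} (hm : gameMove (K k r) f f') : (uncolored f').card = n := by
      obtain ⟨v, c, hv, -, rfl⟩ := hm
      have := card_uncolored_update (c := c) hv
      omega
    rw [isStuck_iff hr hf]
    by_cases ht : aliceTurn f
    · obtain ⟨h1, T', U', c', hs, hB'⟩ := hA _ _ _ (ha ht) hne
      refine ⟨fun h => by have := h1 h.1; omega, Or.inl ⟨ht, ?_⟩⟩
      obtain ⟨f', hm, rfl, rfl, rfl⟩ := exists_gameMove_of_step hr hf hs
      refine ⟨f', hm, ih f' (hf.of_gameMove hm) (next hm) (fun h => ?_) fun _ => hB'⟩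
      exact absurd ht ((aliceTurn_gameMove hm).1 h)
    · obtain ⟨h1, h2⟩ := hB _ _ _ (hb ht)
      refine ⟨fun h => by have := h1 h.1; omega, Or.inr ⟨ht, fun f' hm => ?_⟩⟩
      refine ih f' (hf.of_gameMove hm) (next hm) (fun _ => h2 _ _ _ (step_of_gameMove hm)) ?_
      exact fun h => absurd ((aliceTurn_gameMove hm).2 ht) h

lemma not_aliceWinsFrom_of_bob (hr : ∀ i, 2 ≤ r i) (n : ℕ)
    (f : (Σ i : Fin k, Fin (r i)) → Option (Fin m)) (hf : Proper f)
    (ha : aliceTurn f → BobA r (untouched f) (loose f) (unused f).card)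
    (hb : ¬ aliceTurn f → BobB r (untouched f) (loose f) (unused f).card) :
    ¬ aliceWinsFrom (K k r) n f := by
  have hT : (untouched f).Nonempty := by
    refine Finset.card_pos.1 ?_
    by_cases ht : aliceTurn f
    · have := (ha ht).2.1; omega
    · have := (hb ht).2.1; omega
  have hfull := not_isFull_of_nonempty hr hT
  induction n generalizing f with
  | zero => exact hfull
  | succ n ih =>
    have step {f'} (hm : gameMove (K k r) f f')
        (ha' : aliceTurn f' → BobA r (untouched f') (loose f') (unused f').card)
        (hb' : ¬ aliceTurn f' → BobB r (untouched f') (loose f') (unused f').card) :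
        ¬ aliceWinsFrom (K k r) n f' := by
      have hT' : (untouched f').Nonempty := by
        refine Finset.card_pos.1 ?_
        by_cases ht : aliceTurn f'
        · have := (ha' ht).2.1; omega
        · have := (hb' ht).2.1; omega
      exact ih f' (hf.of_gameMove hm) ha' hb' hT' (not_isFull_of_nonempty hr hT')
    rintro (h | ⟨hstuck, ⟨ht, f', hm, h⟩ | ⟨ht, h⟩⟩)
    · exact hfull h
    · exact step hm (fun h' => absurd ht ((aliceTurn_gameMove hm).1 h'))
        (fun _ => (ha ht).step hr (step_of_gameMove hm)) h
    · rw [isStuck_iff hr hf] at hstuck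
      obtain ⟨T', U', c', hs, hA'⟩ := (hb ht).step hr
        (Nat.pos_of_ne_zero fun h0 => hstuck ⟨hT, h0⟩)
      obtain ⟨f', hm, rfl, rfl, rfl⟩ := exists_gameMove_of_step hr hf hs
      exact step hm (fun _ => hA') (fun h' => absurd ((aliceTurn_gameMove hm).2 ht) h') (h f' hm)

variable (r m)

lemma proper_empty : Proper (fun _ : Σ i : Fin k, Fin (r i) => (none : Option (Fin m))) := by
  simp [Proper]

lemma aliceTurn_empty :
    aliceTurn (fun _ : Σ i : Fin k, Fin (r i) => (none : Option (Fin m))) := by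
  simp [aliceTurn]

lemma untouched_empty :
    untouched (fun _ : Σ i : Fin k, Fin (r i) => (none : Option (Fin m))) = Finset.univ := by
  simp [untouched]

lemma loose_empty :
    loose (fun _ : Σ i : Fin k, Fin (r i) => (none : Option (Fin m))) = 0 := by
  simp [loose, untouched_empty]

lemma card_unused_empty :
    (unused (fun _ : Σ i : Fin k, Fin (r i) => (none : Option (Fin m)))).card = m := by
  simp [unused]

variable {r m}

lemma aliceWins_of_invariant (hr : ∀ i, 2 ≤ r i) {A B : Finset (Fin k) → ℕ → ℕ → Prop}
    (hA : ∀ T U c, A T U c → (T.Nonempty ∨ 0 < U) → (T.Nonempty → 0 < c) ∧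
      ∃ T' U' c', Step r T U c T' U' c' ∧ B T' U' c')
    (hB : ∀ T U c, B T U c → (T.Nonempty → 0 < c) ∧
      ∀ T' U' c', Step r T U c T' U' c' → A T' U' c')
    (h : A Finset.univ 0 m) : aliceWins (K k r) m := by
  refine aliceWinsFrom_of_invariant hr hA hB _ _ (proper_empty m r) ?_ (fun _ => ?_)
    fun h' => absurd (aliceTurn_empty m r) h'
  · simp [uncolored]
  · rwa [untouched_empty, loose_empty, card_unused_empty]

lemma not_aliceWins_of_bob (hr : ∀ i, 2 ≤ r i) (h : BobA r Finset.univ 0 m) :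
    ¬ aliceWins (K k r) m := by
  refine not_aliceWinsFrom_of_bob hr _ _ (proper_empty m r) (fun _ => ?_)
    fun h' => absurd (aliceTurn_empty m r) h'
  rwa [untouched_empty, loose_empty, card_unused_empty]

end Position

end MultipartiteGame

theorem game_chromatic_eq_of_min_two_three_odd (k : ℕ) (hk : 3 ≤ k) (r : Fin k → ℕ)
    (hanti : Antitone r) (hlast : r ⟨k - 1, by omega⟩ = 2) (h3 : ∃ j, r j = 3)
    (hodd : Odd (∑ i, r i)) :
    gameChromaticNumber (K k r) = min (2 * k - 2) (∑ i, (r i + 1) / 2) := by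
  have hr : ∀ i, 2 ≤ r i := fun i => hlast ▸ hanti (Fin.le_def.2 (by simp; omega))
  obtain ⟨j, hj⟩ := h3
  refine IsLeast.csInf_eq (s := {m | aliceWins (K k r) m}) ⟨?_, fun m hm => ?_⟩
  · rcases le_total (2 * k - 2) (∑ i, (r i + 1) / 2) with h | h
    · rw [min_eq_left h]
      refine MultipartiteGame.aliceWins_of_invariant hr
        (fun T U c h hne => MultipartiteGame.TempoA.step hr h hne) (fun T U c h => h.step) ?_
      refine Or.inr (Or.inr ⟨rfl, ?_, ?_, j, Finset.mem_univ j, hj⟩) <;>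
        simp only [Finset.card_univ, Fintype.card_fin] <;> omega
    · rw [min_eq_right h]
      refine MultipartiteGame.aliceWins_of_invariant hr
        (fun T U c h _ => MultipartiteGame.PairA.step hr h) (fun T U c h => h.step hr) ?_
      exact ⟨le_rfl, Nat.odd_iff.1 hodd⟩
  · by_contra! hlt
    obtain ⟨h1, h2⟩ := lt_min_iff.1 hlt
    refine MultipartiteGame.not_aliceWins_of_bob hr ⟨h2, ?_, by omega, fun _ _ _ => ?_⟩ hm <;>
      simp only [Finset.card_univ, Fintype.card_fin] <;> omega
end

section
/- For every r ≥ 5, the complete 3-partite graph K_{r,r,1} (two parts of size r and one singleton part) has game chromatic number χ_g(K_{r,r,1}) = 3. -/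
/-- A partial coloring is proper if adjacent vertices never carry the same color. -/
def IsProperPartial {V C : Type} (G : SimpleGraph V) (f : V → Option C) : Prop :=
  ∀ v w c, G.Adj v w → f v = some c → f w ≠ some c

theorem IsProperPartial.gameMove {V C : Type} [DecidableEq V] {G : SimpleGraph V}
    {f f' : V → Option C} (hf : IsProperPartial G f) (h : gameMove G f f') :
    IsProperPartial G f' := by
  obtain ⟨u, e, -, hl, rfl⟩ := h
  intro v w c hvw hv hw
  rcases eq_or_ne v u with rfl | hvu
  · rw [Function.update_self] at hv
    rw [Function.update_of_ne hvw.ne'] at hw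
    exact hl w hvw (hw.trans hv.symm)
  · rw [Function.update_of_ne hvu] at hv
    rcases eq_or_ne w u with rfl | hwu
    · rw [Function.update_self] at hw
      exact hl v hvw.symm (hv.trans hw.symm)
    · rw [Function.update_of_ne hwu] at hw
      exact hf v w c hvw hv hw

theorem exists_gameMove {V C : Type} [DecidableEq V] {G : SimpleGraph V}
    {f : V → Option C} (hfull : ¬ isFull f) (hstuck : ¬ isStuck G f) :
    ∃ f', gameMove G f f' := by
  simp only [isFull, not_forall, Option.not_isSome_iff_eq_none] at hfull
  obtain ⟨v, hv⟩ := hfull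
  simp only [isStuck, not_exists, not_and, not_forall, not_not] at hstuck
  obtain ⟨c, hc⟩ := hstuck v hv
  exact ⟨_, v, c, hv, hc, rfl⟩

theorem IsProperPartial.nonempty_coloring {V C : Type} {G : SimpleGraph V} {f : V → Option C}
    (hf : IsProperPartial G f) (hfull : isFull f) : Nonempty (G.Coloring C) := by
  refine ⟨SimpleGraph.Coloring.mk (fun v => (f v).get (hfull v)) ?_⟩
  intro v w hvw heq
  exact hf v w _ hvw (Option.some_get (hfull v)).symm
    (heq ▸ (Option.some_get (hfull w)).symm)

theorem nonempty_coloring_of_aliceWinsFrom {V C : Type} [Fintype V] [DecidableEq V]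
    {G : SimpleGraph V} (n : ℕ) (f : V → Option C) (hf : IsProperPartial G f)
    (h : aliceWinsFrom G n f) : Nonempty (G.Coloring C) := by
  induction n generalizing f with
  | zero => exact hf.nonempty_coloring h
  | succ n ih =>
    by_cases hfull : isFull f
    · exact hf.nonempty_coloring hfull
    rcases h with h | ⟨hstuck, ⟨-, f', hm, h⟩ | ⟨-, h⟩⟩
    · exact absurd h hfull
    · exact ih f' (hf.gameMove hm) h
    · obtain ⟨f', hm⟩ := exists_gameMove hfull hstuck
      exact ih f' (hf.gameMove hm) (h f' hm)

/-- If Alice wins with `m` colors, then the graph is `m`-colorable. -/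
theorem colorable_of_aliceWins {V : Type} [Fintype V] [DecidableEq V]
    {G : SimpleGraph V} {m : ℕ} (h : aliceWins G m) : G.Colorable m :=
  nonempty_coloring_of_aliceWinsFrom _ _ (fun _ _ _ _ hv => by simp at hv) h

theorem card_colored_update {V C : Type} [Fintype V] [DecidableEq V] {f : V → Option C}
    {v : V} (hv : f v = none) (c : C) :
    (Finset.univ.filter (fun w => (Function.update f v (some c) w).isSome = true)).card =
      (Finset.univ.filter (fun w => (f w).isSome = true)).card + 1 := by
  rw [← Finset.card_insert_of_notMem (a := v) (by simp [hv])]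
  congr 1
  ext w
  rcases eq_or_ne w v with rfl | h
  · simp
  · simp [h]

theorem aliceTurn_update_iff {V C : Type} [Fintype V] [DecidableEq V] {f : V → Option C}
    {v : V} (hv : f v = none) (c : C) :
    aliceTurn (Function.update f v (some c)) ↔ ¬ aliceTurn f := by
  rw [aliceTurn, card_colored_update hv, Nat.even_add_one, aliceTurn]

/-- A property that is preserved by all moves and excludes stuck positions is winning
for Alice. -/
theorem aliceWinsFrom_of_invariant {V C : Type} [Fintype V] [DecidableEq V]
    {G : SimpleGraph V} (P : (V → Option C) → Prop) (hstuck : ∀ f, P f → ¬ isStuck G f)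
    (hmove : ∀ f f', P f → gameMove G f f' → P f') (n : ℕ) (f : V → Option C) (hf : P f)
    (hn : Fintype.card V ≤ (Finset.univ.filter (fun v => (f v).isSome = true)).card + n) :
    aliceWinsFrom G n f := by
  induction n generalizing f with
  | zero =>
    have := Finset.eq_univ_of_card _ (le_antisymm (Finset.card_le_univ _) hn)
    intro v
    have hv := this ▸ Finset.mem_univ v
    simpa using hv
  | succ n ih =>
    by_cases hfull : isFull f
    · exact Or.inl hfull
    have step : ∀ f', gameMove G f f' → aliceWinsFrom G n f' := by
      intro f' hm
      refine ih f' (hmove f f' hf hm) ?_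
      obtain ⟨v, c, hv, -, rfl⟩ := hm
      rw [card_colored_update hv]
      omega
    refine Or.inr ⟨hstuck f hf, ?_⟩
    by_cases ht : aliceTurn f
    · obtain ⟨f', hm⟩ := exists_gameMove hfull (hstuck f hf)
      exact Or.inl ⟨ht, f', hm, step f' hm⟩
    · exact Or.inr ⟨ht, step⟩

/-- Every part contains a colored vertex, and all colored vertices of part `i` have color
`col i`. -/
def IsPartwise {k : ℕ} {r : Fin k → ℕ} {C : Type} (col : Fin k → C)
    (f : (Σ i : Fin k, Fin (r i)) → Option C) : Prop :=
  (∀ i, ∃ v, v.1 = i ∧ (f v).isSome) ∧ ∀ v c, f v = some c → c = col v.1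

theorem IsPartwise.legalColor {k : ℕ} {r : Fin k → ℕ} {C : Type} {col : Fin k → C}
    {f : (Σ i : Fin k, Fin (r i)) → Option C} (hcol : Function.Injective col)
    (hf : IsPartwise col f) (v : Σ i : Fin k, Fin (r i)) :
    legalColor (K k r) f v (col v.1) := by
  intro w hvw hw
  exact hvw (hcol (hf.2 w _ hw))

theorem IsPartwise.gameMove {k : ℕ} {r : Fin k → ℕ} {C : Type} {col : Fin k → C}
    {f f' : (Σ i : Fin k, Fin (r i)) → Option C} (hcol : Function.Surjective col)
    (hf : IsPartwise col f) (hm : gameMove (K k r) f f') : IsPartwise col f' := by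
  obtain ⟨u, e, -, hl, rfl⟩ := hm
  constructor
  · intro i
    obtain ⟨v, hv, hs⟩ := hf.1 i
    refine ⟨v, hv, ?_⟩
    rcases eq_or_ne v u with rfl | h
    · simp
    · simpa [h] using hs
  · intro v c hv
    rcases eq_or_ne v u with rfl | h
    · rw [Function.update_self, Option.some_inj] at hv
      subst hv
      obtain ⟨j, rfl⟩ := hcol e
      obtain ⟨w, rfl, hs⟩ := hf.1 j
      obtain ⟨b, hb⟩ := Option.isSome_iff_exists.1 hs
      by_contra hne
      refine hl w (fun h : v.1 = w.1 => hne (by rw [h])) ?_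
      rw [hb, hf.2 w b hb]
    · rw [Function.update_of_ne h] at hv
      exact hf.2 v c hv

theorem not_isStuck_of_unused {V C : Type} {G : SimpleGraph V} {f : V → Option C} (c : C)
    (hc : ∀ w, f w ≠ some c) : ¬ isStuck G f :=
  fun ⟨_, _, h⟩ => h c fun w _ => hc w

/-- Alice colors the singleton part, and then the part which Bob did not play in. -/
theorem aliceWins_K_singleton_part {r : ℕ} (hr : 0 < r) : aliceWins (K 3 ![r, r, 1]) 3 := by
  have hcard : Fintype.card (Σ i : Fin 3, Fin (![r, r, 1] i)) = (2 * r - 2) + 3 := by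
    simp [Fin.sum_univ_three]
    omega
  rw [aliceWins, hcard]
  set z : Σ i : Fin 3, Fin (![r, r, 1] i) := ⟨2, (0 : Fin 1)⟩ with hz
  have hz_unique : ∀ v : Σ i : Fin 3, Fin (![r, r, 1] i), v.1 = 2 → v = z := by
    rintro ⟨i, x⟩ h
    obtain rfl : i = 2 := h
    exact congrArg _ (Subsingleton.elim (α := Fin 1) x 0)
  have hempty : aliceTurn (fun _ : Σ i : Fin 3, Fin (![r, r, 1] i) => (none : Option (Fin 3))) := by
    simp [aliceTurn]
  set f₁ : (Σ i : Fin 3, Fin (![r, r, 1] i)) → Option (Fin 3) :=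
    Function.update (fun _ => none) z (some 0) with hf₁
  have hturn₁ : ¬ aliceTurn f₁ := by
    rw [hf₁, aliceTurn_update_iff rfl]
    exact not_not.2 hempty
  have hval₁ : ∀ w c, f₁ w = some c → w = z ∧ c = 0 := by
    intro w c hw
    rcases eq_or_ne w z with h | h
    · subst h
      exact ⟨rfl, by simpa [hf₁, eq_comm] using hw⟩
    · simp [hf₁, h] at hw
  refine Or.inr ⟨not_isStuck_of_unused 0 (by simp), Or.inl ⟨hempty, f₁,
    ⟨z, 0, rfl, fun _ _ => by simp, rfl⟩, Or.inr ⟨not_isStuck_of_unused 1 fun w hw => ?_,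
    Or.inr ⟨hturn₁, ?_⟩⟩⟩⟩
  · exact absurd (hval₁ w 1 hw).2 (by decide)
  rintro f₂ ⟨v, c, hv, hl, hf₂⟩
  have hvz : v ≠ z := by
    rintro rfl
    simp [hf₁] at hv
  have hv2 : v.1 ≠ 2 := fun h => hvz (hz_unique v h)
  have hc : c ≠ 0 := by
    rintro rfl
    exact hl z hv2 (by simp [hf₁])
  obtain ⟨d, hd0, hdc⟩ : ∃ d : Fin 3, d ≠ 0 ∧ d ≠ c :=
    (by decide : ∀ c : Fin 3, ∃ d : Fin 3, d ≠ 0 ∧ d ≠ c) c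
  obtain ⟨w, hw2, hwv⟩ : ∃ w : Σ i : Fin 3, Fin (![r, r, 1] i), w.1 ≠ 2 ∧ w.1 ≠ v.1 := by
    by_cases h : v.1 = 0
    · exact ⟨⟨1, (⟨0, hr⟩ : Fin r)⟩, by simp, by simp [h]⟩
    · exact ⟨⟨0, (⟨0, hr⟩ : Fin r)⟩, by simp, fun h' => h h'.symm⟩
  have hwz : w ≠ z := fun h => hw2 (by rw [h])
  have hwv' : w ≠ v := fun h => hwv (by rw [h])
  have hval₂ : ∀ u e, f₂ u = some e → u = v ∧ e = c ∨ u = z ∧ e = 0 := by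
    intro u e hu
    rcases eq_or_ne u v with h | h
    · subst h
      exact Or.inl ⟨rfl, by simpa [hf₂, eq_comm] using hu⟩
    · rw [hf₂, Function.update_of_ne h] at hu
      exact Or.inr (hval₁ u e hu)
  have hd_unused : ∀ u, f₂ u ≠ some d := by
    intro u hu
    rcases hval₂ u d hu with ⟨-, h⟩ | ⟨-, h⟩
    · exact hdc h
    · exact hd0 h
  have hw_none : f₂ w = none := by simp [hf₂, hf₁, hwz, hwv']
  have hturn₂ : aliceTurn f₂ := by
    rw [hf₂, aliceTurn_update_iff hv]
    exact hturn₁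
  refine Or.inr ⟨not_isStuck_of_unused d hd_unused, Or.inl ⟨hturn₂, _,
    ⟨w, d, hw_none, fun u _ => hd_unused u, rfl⟩, ?_⟩⟩
  have hparts : ∀ i : Fin 3, i = 2 ∨ i = v.1 ∨ i = w.1 := by
    generalize v.1 = a at *
    generalize w.1 = b at *
    clear * - hv2 hw2 hwv
    revert a b
    decide
  let col : Fin 3 → Fin 3 := fun i => if i = 2 then 0 else if i = v.1 then c else d
  have hcol : Function.Injective col := by
    intro i j hij
    rcases hparts i with rfl | rfl | rfl <;> rcases hparts j with rfl | rfl | rfl <;>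
      first | rfl | simp [col, hv2, hw2, hwv, hc, hc.symm, hd0, hd0.symm, hdc, hdc.symm] at hij
  refine aliceWinsFrom_of_invariant (IsPartwise col) ?_ ?_ _ _ ⟨?_, ?_⟩ ?_
  · rintro f hf ⟨u, -, hu⟩
    exact hu _ (hf.legalColor hcol u)
  · exact fun f f' hf => hf.gameMove (Finite.injective_iff_surjective.1 hcol)
  · intro i
    rcases hparts i with rfl | rfl | rfl
    · exact ⟨z, rfl, by simp [hf₂, hf₁, hwz.symm, hvz.symm]⟩
    · exact ⟨v, rfl, by simp [hf₂, hwv'.symm]⟩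
    · exact ⟨w, rfl, by simp⟩
  · intro u e hu
    rcases eq_or_ne u w with rfl | h
    · rw [Function.update_self, Option.some_inj] at hu
      simp [col, hw2, hwv, hu]
    · rw [Function.update_of_ne h] at hu
      rcases hval₂ u e hu with ⟨rfl, rfl⟩ | ⟨rfl, rfl⟩
      · simp [col, hv2]
      · simp [col, hz]
  · rw [card_colored_update hw_none, hf₂, card_colored_update hv, hf₁, card_colored_update rfl,
      hcard]
    omega

theorem le_of_colorable_K {k m : ℕ} {r : Fin k → ℕ} (hr : ∀ i, 0 < r i)
    (h : (K k r).Colorable m) : k ≤ m := by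
  obtain ⟨g⟩ := h
  have hinj : Function.Injective (fun i : Fin k => g ⟨i, ⟨0, hr i⟩⟩) := by
    intro i j hij
    by_contra hne
    exact g.valid (v := ⟨i, ⟨0, hr i⟩⟩) (w := ⟨j, ⟨0, hr j⟩⟩) hne hij
  simpa using Fintype.card_le_of_injective _ hinj

theorem game_chromatic_Krr1 (r : ℕ) (hr : 5 ≤ r) :
    gameChromaticNumber (K 3 ![r, r, 1]) = 3 := by
  have hr0 : 0 < r := by omega
  refine IsLeast.csInf_eq ⟨aliceWins_K_singleton_part hr0, fun m hm => ?_⟩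
  refine le_of_colorable_K (fun i => ?_) (colorable_of_aliceWins hm)
  fin_cases i
  exacts [hr0, hr0, one_pos]
end
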